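/- arXiv:2511.05788 — 2 statements merged into one kernel-verified Lean document; each statement's English description precedes it below -/
import Mathlib

section
/- Consider the HAR method run with ψ ≡ 0 (so F = f) and p ≥ 2. For every successful iteration k ∈ S (so that x^k = x^{k−1} + d^k), the Hessian satisfies λ_min(∇²f(x^k)) ≥ −(2 α H_max / (p−1)!) · ‖d^k‖^{p−1}, i.e. ⟨∇²f(x^k) h, h⟩ ≥ −(2 α H_max / (p−1)!) ‖d^k‖^{p−1} ‖h‖² for all h ∈ ℝ^n, where H_max = max{H_0, L_p}. -/
open scoped BigOperators RealInnerProductSpace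

noncomputable section

/-- The `p`-th order Taylor polynomial `T_p(y; x)` of `f` at `x`, evaluated at `y`. -/
def taylorPoly {n : ℕ} (p : ℕ) (f : EuclideanSpace ℝ (Fin n) → ℝ)
    (x y : EuclideanSpace ℝ (Fin n)) : ℝ :=
  f x + ∑ ℓ ∈ Finset.Icc 1 p,
    (1 / (Nat.factorial ℓ : ℝ)) * iteratedFDeriv ℝ ℓ f x (fun _ => y - x)

/-- The regularized Taylor polynomial `Ω_p^σ(y; x)`. -/
def omegaReg {n : ℕ} (p : ℕ) (σ : ℝ) (f : EuclideanSpace ℝ (Fin n) → ℝ)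
    (x y : EuclideanSpace ℝ (Fin n)) : ℝ :=
  taylorPoly p f x y + σ / (Nat.factorial (p + 1) : ℝ) * ‖y - x‖ ^ (p + 1)

/-- `H_max = max {H₀, L_p}`. -/
def Hmax (H0 Lp : ℝ) : ℝ := max H0 Lp

/-- `Ū = ⌈log_{(α+1)/2} (H_max / H₀)⌉`. -/
def Ubar (α H0 Lp : ℝ) : ℤ := ⌈Real.logb ((α + 1) / 2) (Hmax H0 Lp / H0)⌉

section Taylor

variable {E : Type*} [NormedAddCommGroup E] [NormedSpace ℝ E] {f : E → ℝ} {p : ℕ}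

lemma iteratedFDeriv_succ_cons (hf : ContDiff ℝ p f) {k : ℕ} (hk : k < p) (y a : E)
    (m : Fin k → E) :
    iteratedFDeriv ℝ (k + 1) f y (Fin.cons a m)
      = fderiv ℝ (fun z => iteratedFDeriv ℝ k f z m) y a := by
  have h := (hf.differentiable_iteratedFDeriv (m := k) (by exact_mod_cast hk) y)
  rw [h.iteratedFDeriv_succ_apply_left']
  simp

lemma iteratedFDeriv_cons_congr (hf : ContDiff ℝ p f) {k : ℕ} (hk : k < p)
    {m m' : Fin k → E} (h : ∀ y, iteratedFDeriv ℝ k f y m = iteratedFDeriv ℝ k f y m') (y a : E) :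
    iteratedFDeriv ℝ (k + 1) f y (Fin.cons a m) = iteratedFDeriv ℝ (k + 1) f y (Fin.cons a m') := by
  rw [iteratedFDeriv_succ_cons hf hk, iteratedFDeriv_succ_cons hf hk, funext h]

lemma iteratedFDeriv_cons_cons_comm (hf : ContDiff ℝ p f) {k : ℕ} (hk : k + 2 ≤ p) (y a b : E)
    (m : Fin k → E) :
    iteratedFDeriv ℝ (k + 2) f y (Fin.cons a (Fin.cons b m))
      = iteratedFDeriv ℝ (k + 2) f y (Fin.cons b (Fin.cons a m)) := by
  have hφ : ContDiff ℝ 2 (fun z => iteratedFDeriv ℝ k f z m) := by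
    have h := hf.iteratedFDeriv_right (m := 2) (i := k) (by norm_cast; omega)
    exact (ContinuousMultilinearMap.apply ℝ (fun _ : Fin k => E) ℝ m).contDiff.comp h
  have hd : Differentiable ℝ (fderiv ℝ (fun z => iteratedFDeriv ℝ k f z m)) :=
    (hφ.fderiv_right (m := 1) (by norm_num)).differentiable (by norm_num)
  have key : ∀ a b : E, iteratedFDeriv ℝ (k + 2) f y (Fin.cons a (Fin.cons b m))
      = fderiv ℝ (fderiv ℝ (fun z => iteratedFDeriv ℝ k f z m)) y a b := by
    intro a b
    rw [iteratedFDeriv_succ_cons hf (by omega)]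
    simp_rw [iteratedFDeriv_succ_cons hf (show k < p by omega)]
    rw [fderiv_clm_apply (hd y) (by fun_prop)]
    simp
  rw [key, key]
  exact (hφ.contDiffAt.isSymmSndFDerivAt (by simp)).eq a b

lemma iteratedFDeriv_update_const (hf : ContDiff ℝ p f) (v h : E) :
    ∀ {k : ℕ}, k + 1 ≤ p → ∀ (i : Fin (k + 1)) (y : E),
    iteratedFDeriv ℝ (k + 1) f y (Function.update (fun _ => v) i h)
      = iteratedFDeriv ℝ (k + 1) f y (Fin.cons h (fun _ => v)) := by
  intro k
  induction k with
  | zero =>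
    intro _ i y
    obtain rfl : i = 0 := Subsingleton.elim (α := Fin 1) i 0
    congr 1
    ext1 j
    obtain rfl : j = 0 := Subsingleton.elim (α := Fin 1) j 0
    simp
  | succ k ih =>
    intro hk i y
    have hconst : ∀ n : ℕ, (fun _ : Fin (n + 1) => v) = Fin.cons v (fun _ => v) := by
      intro n; ext j; refine Fin.cases ?_ (fun _ => ?_) j <;> simp
    refine Fin.cases ?_ (fun i => ?_) i
    · rw [hconst (k + 1), Fin.update_cons_zero]
    · rw [hconst (k + 1), ← Fin.cons_update, iteratedFDeriv_cons_congr hf (by omega)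
        (ih (by omega) i), iteratedFDeriv_cons_cons_comm hf (by omega), ← hconst]

lemma ContinuousMultilinearMap.hasDerivAt_line {k : ℕ}
    (A : ContinuousMultilinearMap ℝ (fun _ : Fin k => E) ℝ) (u h : E) (s : ℝ) :
    HasDerivAt (fun s : ℝ => A (fun _ => u + s • h))
      (∑ i, A (Function.update (fun _ => u + s • h) i h)) s := by
  have h1 : HasDerivAt (fun s : ℝ => (fun _ : Fin k => u + s • h)) (fun _ => h) s := by
    rw [hasDerivAt_pi]
    intro _
    simpa using ((hasDerivAt_id s).smul_const h).const_add u
  have h2 := (A.hasFDerivAt (fun _ => u + s • h)).comp_hasDerivAt s h1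
  simpa [ContinuousMultilinearMap.linearDeriv_apply, Function.comp_def] using! h2

lemma hasDerivAt_iteratedFDeriv_const_line (hf : ContDiff ℝ p f) {k : ℕ} (hk : k + 1 ≤ p)
    (x u h : E) (s : ℝ) :
    HasDerivAt (fun s : ℝ => iteratedFDeriv ℝ (k + 1) f x (fun _ => u + s • h))
      ((k + 1) * iteratedFDeriv ℝ (k + 1) f x (Fin.cons h (fun _ => u + s • h))) s := by
  have h1 := (iteratedFDeriv ℝ (k + 1) f x).hasDerivAt_line u h s
  simpa [iteratedFDeriv_update_const hf _ h hk] using h1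

lemma hasDerivAt_iteratedFDeriv_cons_line (hf : ContDiff ℝ p f) {k : ℕ} (hk : k + 2 ≤ p)
    (x u h : E) (s : ℝ) :
    HasDerivAt (fun s : ℝ => iteratedFDeriv ℝ (k + 2) f x (Fin.cons h (fun _ => u + s • h)))
      ((k + 1) * iteratedFDeriv ℝ (k + 2) f x
        (Fin.cons h (Fin.cons h (fun _ => u + s • h)))) s := by
  have h1 := ((iteratedFDeriv ℝ (k + 2) f x).curryLeft h).hasDerivAt_line u h s
  have h2 : ∀ i : Fin (k + 1), iteratedFDeriv ℝ (k + 2) f x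
      (Function.update (Fin.cons h (fun _ => u + s • h)) i.succ h) = iteratedFDeriv ℝ (k + 2) f x
        (Fin.cons h (Fin.cons h (fun _ => u + s • h))) := fun i => by
    rw [← Fin.cons_update]
    exact iteratedFDeriv_cons_congr hf (by omega)
      (iteratedFDeriv_update_const hf _ h (by omega) i) x h
  simpa [ContinuousMultilinearMap.curryLeft_apply, h2] using h1

lemma hasDerivAt_iteratedFDeriv_line (hf : ContDiff ℝ p f) {k : ℕ} (hk : k < p) (x d : E)
    (m : Fin k → E) (t : ℝ) :
    HasDerivAt (fun t : ℝ => iteratedFDeriv ℝ k f (x + t • d) m)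
      (iteratedFDeriv ℝ (k + 1) f (x + t • d) (Fin.cons d m)) t := by
  rw [iteratedFDeriv_succ_cons hf hk]
  have hφ : Differentiable ℝ (fun z => iteratedFDeriv ℝ k f z m) :=
    (ContinuousMultilinearMap.apply ℝ (fun _ : Fin k => E) ℝ m).differentiable.comp
      (hf.differentiable_iteratedFDeriv (by exact_mod_cast hk))
  have h1 : HasDerivAt (fun t : ℝ => x + t • d) d t := by
    simpa using ((hasDerivAt_id t).smul_const d).const_add x
  exact (hφ (x + t • d)).hasFDerivAt.comp_hasDerivAt t h1

/-- Taylor's theorem in Lagrange form for a finite chain of successive derivatives whose last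
member satisfies a Lipschitz bound at the base point. -/
lemma abs_sub_taylor_sum_le (q : ℕ) (C : ℝ) (φ : ℕ → ℝ → ℝ)
    (hφ : ∀ j < q, ∀ t, HasDerivAt (φ j) (φ (j + 1) t) t)
    (hq : ∀ t, 0 ≤ t → |φ q t - φ q 0| ≤ C * t) :
    ∀ t, 0 ≤ t → |φ 0 t - ∑ j ∈ Finset.range (q + 1), φ j 0 * t ^ j / (Nat.factorial j : ℝ)|
      ≤ C * t ^ (q + 1) / (Nat.factorial (q + 1) : ℝ) := by
  induction q generalizing φ with
  | zero => intro t ht; simpa using hq t ht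
  | succ q ih =>
    intro t ht
    have ih' := ih (fun j => φ (j + 1)) (fun j hj s => hφ (j + 1) (by omega) s) hq
    have hpow : ∀ (c : ℝ) (j : ℕ) (s : ℝ),
        HasDerivAt (fun s : ℝ => c * s ^ (j + 1) / (Nat.factorial (j + 1) : ℝ))
          (c * s ^ j / (Nat.factorial j : ℝ)) s := by
      intro c j s
      convert! ((hasDerivAt_pow (j + 1) s).const_mul c).div_const
        (Nat.factorial (j + 1) : ℝ) using 1
      have := Nat.factorial_ne_zero j
      rw [Nat.factorial_succ]
      push_cast
      field_simp
    have hF : ∀ s : ℝ, HasDerivAt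
        (fun t => φ 0 t - ∑ j ∈ Finset.range (q + 1 + 1), φ j 0 * t ^ j / (Nat.factorial j : ℝ))
        (φ 1 s - ∑ j ∈ Finset.range (q + 1), φ (j + 1) 0 * s ^ j / (Nat.factorial j : ℝ)) s := by
      intro s
      refine (hφ 0 (by omega) s).sub ?_
      simp_rw [Finset.sum_range_succ' _ (q + 1)]
      simpa using! (HasDerivAt.fun_sum fun j _ => hpow (φ (j + 1) 0) j s).add_const (φ 0 0)
    have := image_norm_le_of_norm_deriv_right_le_deriv_boundary (a := 0) (b := t)
      (fun s _ => (hF s).continuousAt.continuousWithinAt) (fun s _ => (hF s).hasDerivWithinAt)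
      (B := fun s => C * s ^ (q + 1 + 1) / (Nat.factorial (q + 1 + 1) : ℝ))
      (B' := fun s => C * s ^ (q + 1) / (Nat.factorial (q + 1) : ℝ))
      (by simp [Finset.sum_range_succ']) (hpow C (q + 1))
      (fun s hs => ih' s hs.1) (Set.right_mem_Icc.2 ht)
    exact this

lemma abs_iteratedFDeriv_line_sub_le {L : ℝ}
    (hLip : ∀ x y, ‖iteratedFDeriv ℝ p f x - iteratedFDeriv ℝ p f y‖ ≤ L * ‖x - y‖)
    (x d : E) (m : Fin p → E) (t : ℝ) (ht : 0 ≤ t) :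
    |iteratedFDeriv ℝ p f (x + t • d) m - iteratedFDeriv ℝ p f (x + (0 : ℝ) • d) m|
      ≤ (L * ‖d‖ * ∏ i, ‖m i‖) * t := by
  have h1 := (iteratedFDeriv ℝ p f (x + t • d) - iteratedFDeriv ℝ p f x).le_opNorm m
  have h2 := hLip (x + t • d) x
  rw [add_sub_cancel_left, norm_smul, Real.norm_of_nonneg ht] at h2
  have h3 : 0 ≤ ∏ i, ‖m i‖ := Finset.prod_nonneg fun i _ => norm_nonneg _
  simp only [zero_smul, add_zero]
  calc _ ≤ _ := h1
    _ ≤ (L * (t * ‖d‖)) * ∏ i, ‖m i‖ := by gcongr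
    _ = _ := by ring

lemma abs_sub_taylor_le {L : ℝ} (hf : ContDiff ℝ p f)
    (hLip : ∀ x y, ‖iteratedFDeriv ℝ p f x - iteratedFDeriv ℝ p f y‖ ≤ L * ‖x - y‖) (x d : E) :
    |f (x + d) - ∑ j ∈ Finset.range (p + 1),
        iteratedFDeriv ℝ j f x (fun _ => d) / (Nat.factorial j : ℝ)|
      ≤ L * ‖d‖ ^ (p + 1) / (Nat.factorial (p + 1) : ℝ) := by
  have h := abs_sub_taylor_sum_le p (L * ‖d‖ * ‖d‖ ^ p)
    (fun j t => iteratedFDeriv ℝ j f (x + t • d) (fun _ => d))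
    (fun j hj t => by
      convert! hasDerivAt_iteratedFDeriv_line hf hj x d (fun _ => d) t using 2
      ext i; refine Fin.cases ?_ (fun _ => ?_) i <;> simp)
    (fun t ht => by
      simpa using abs_iteratedFDeriv_line_sub_le hLip x d (fun _ => d) t ht) 1 zero_le_one
  simpa [pow_succ', mul_assoc] using h

lemma abs_hessian_sub_taylor_le {q : ℕ} {L : ℝ} (hf : ContDiff ℝ (q + 2 : ℕ) f)
    (hLip : ∀ x y, ‖iteratedFDeriv ℝ (q + 2) f x - iteratedFDeriv ℝ (q + 2) f y‖ ≤ L * ‖x - y‖)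
    (x d h : E) :
    |iteratedFDeriv ℝ 2 f (x + d) (fun _ => h) - ∑ j ∈ Finset.range (q + 1),
        iteratedFDeriv ℝ (j + 2) f x (Fin.cons h (Fin.cons h (fun _ => d)))
          / (Nat.factorial j : ℝ)|
      ≤ L * ‖d‖ ^ (q + 1) * ‖h‖ ^ 2 / (Nat.factorial (q + 1) : ℝ) := by
  have hh : (fun _ => h : Fin 2 → E) = Fin.cons h (Fin.cons h (fun _ => d)) := by
    ext i; fin_cases i <;> rfl
  have hb := abs_sub_taylor_sum_le q (L * ‖d‖ * (‖h‖ * (‖h‖ * ‖d‖ ^ q)))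
    (fun j t => iteratedFDeriv ℝ (j + 2) f (x + t • d) (Fin.cons h (Fin.cons h (fun _ => d))))
    (fun j hj t => by
      convert! hasDerivAt_iteratedFDeriv_line hf (show j + 2 < q + 2 by omega) x d
        (Fin.cons h (Fin.cons h (fun _ => d))) t using 1
      have hconst : (fun _ : Fin (j + 1) => d) = Fin.cons d (fun _ => d) := by
        ext i; refine Fin.cases ?_ (fun _ => ?_) i <;> simp
      rw [hconst]
      exact (iteratedFDeriv_cons_congr hf (k := j + 2) (by omega)
        (fun y => iteratedFDeriv_cons_cons_comm hf (k := j) (by omega) y h d _) _ h).trans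
        (iteratedFDeriv_cons_cons_comm hf (k := j + 1) (by omega) _ h d _))
    (fun t ht => by
      simpa [Fin.prod_univ_succ] using abs_iteratedFDeriv_line_sub_le hLip x d
        (Fin.cons h (Fin.cons h (fun _ => d))) t ht) 1 zero_le_one
  rw [hh]
  simp only [one_smul, zero_smul, add_zero, one_pow, mul_one] at hb
  convert! hb using 1
  ring

end Taylor

/-- The second-order necessary condition at a global minimum. -/
lemma second_deriv_nonneg_of_min {g g' : ℝ → ℝ} {c : ℝ} (hmin : ∀ s, g 0 ≤ g s)
    (hg : ∀ᶠ s in nhds 0, HasDerivAt g (g' s) s) (hg' : HasDerivAt g' c 0) : 0 ≤ c := by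
  by_contra! hc
  have hd : deriv g =ᶠ[nhds 0] g' := hg.mono fun s hs => hs.deriv
  have hdd : deriv (deriv g) 0 = c := by rw [hd.deriv_eq, hg'.deriv]
  have hloc : IsLocalMin g 0 := Filter.Eventually.of_forall hmin
  have hmax := isLocalMax_of_deriv_deriv_neg (hdd ▸ hc) hloc.deriv_eq_zero
    hg.self_of_nhds.continuousAt
  have hconst : g =ᶠ[nhds 0] fun _ => g 0 := hmax.mono fun s hs => le_antisymm hs (hmin s)
  have : deriv (deriv g) 0 = 0 := by
    have h1 : deriv g =ᶠ[nhds 0] fun _ => 0 := by simpa using! hconst.deriv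
    rw [h1.deriv_eq, deriv_const]
  linarith

section NormPow

variable {E : Type*} [NormedAddCommGroup E] [InnerProductSpace ℝ E]

lemma hasDerivAt_norm_line (d h : E) {s : ℝ} (hs : d + s • h ≠ 0) :
    HasDerivAt (fun s : ℝ => ‖d + s • h‖) (inner ℝ (d + s • h) h / ‖d + s • h‖) s := by
  have h1 : HasDerivAt (fun s : ℝ => d + s • h) h s := by
    simpa using ((hasDerivAt_id s).smul_const h).const_add d
  have h2 := h1.norm_sq.sqrt (by positivity)
  simp only [Real.sqrt_sq (norm_nonneg _)] at h2
  convert! h2 using 1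
  field_simp

lemma hasDerivAt_norm_pow_line (d h : E) (k : ℕ) {s : ℝ} (hs : d + s • h ≠ 0) :
    HasDerivAt (fun s : ℝ => ‖d + s • h‖ ^ (k + 2))
      ((k + 2) * ‖d + s • h‖ ^ k * inner ℝ (d + s • h) h) s := by
  convert! (hasDerivAt_norm_line d h hs).pow (k + 2) using 1
  have : ‖d + s • h‖ ≠ 0 := norm_ne_zero_iff.2 hs
  push_cast
  simp only [pow_succ]
  field_simp

lemma hasDerivAt_norm_pow_mul_inner_line (d h : E) (k : ℕ) (hd : d ≠ 0) :
    ∃ c ≤ (k + 2 : ℝ) * ‖d‖ ^ (k + 1) * ‖h‖ ^ 2,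
      HasDerivAt (fun s : ℝ => ‖d + s • h‖ ^ (k + 1) * inner ℝ (d + s • h) h) c 0 := by
  have hn : 0 < ‖d‖ := norm_pos_iff.2 hd
  have h1 := (hasDerivAt_norm_line d h (s := 0) (by simpa using hd)).pow (k + 1)
  have h2 : HasDerivAt (fun s : ℝ => inner ℝ (d + s • h) h) (‖h‖ ^ 2) 0 := by
    simp_rw [inner_add_left, real_inner_smul_left, ← real_inner_self_eq_norm_sq]
    simpa using ((hasDerivAt_id (0 : ℝ)).mul_const (inner ℝ h h)).const_add (inner ℝ d h)
  refine ⟨_, ?_, h1.mul h2⟩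
  have h3 : (inner ℝ d h : ℝ) ^ 2 ≤ (‖d‖ * ‖h‖) ^ 2 :=
    sq_le_sq' (neg_le_of_abs_le (abs_real_inner_le_norm d h)) (real_inner_le_norm d h)
  have h4 : (inner ℝ d h : ℝ) ^ 2 / ‖d‖ ≤ ‖d‖ * ‖h‖ ^ 2 := by
    rw [div_le_iff₀ hn]; linarith
  simp only [Pi.pow_apply, zero_smul, add_zero, Nat.add_sub_cancel]
  push_cast
  calc _ = (k + 1) * ‖d‖ ^ k * ((inner ℝ d h : ℝ) ^ 2 / ‖d‖) + ‖d‖ ^ (k + 1) * ‖h‖ ^ 2 := by ring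
    _ ≤ (k + 1) * ‖d‖ ^ k * (‖d‖ * ‖h‖ ^ 2) + ‖d‖ ^ (k + 1) * ‖h‖ ^ 2 := by gcongr
    _ = _ := by ring

end NormPow

lemma taylorPoly_eq_sum_range {n : ℕ} (p : ℕ) (f : EuclideanSpace ℝ (Fin n) → ℝ)
    (x u : EuclideanSpace ℝ (Fin n)) :
    taylorPoly p f x (x + u) = ∑ j ∈ Finset.range (p + 1),
      iteratedFDeriv ℝ j f x (fun _ => u) / (Nat.factorial j : ℝ) := by
  rw [taylorPoly, Finset.sum_range_succ', add_comm, Finset.range_eq_Ico, Finset.sum_Ico_add'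
    (fun j => iteratedFDeriv ℝ j f x (fun _ => u) / (Nat.factorial j : ℝ)) 0 p 1]
  simp only [add_sub_cancel_left]
  congr 1
  · exact Finset.sum_congr (by ext; simp) fun j _ => by ring
  · simp

/-- The Hessian of the Taylor model at a global minimizer of the regularized model. -/
lemma hessian_taylor_ge_of_min {n q : ℕ} {f : EuclideanSpace ℝ (Fin n) → ℝ} {σ : ℝ}
    (hf : ContDiff ℝ (q + 2 : ℕ) f) (hσ : 0 ≤ σ) (x d h : EuclideanSpace ℝ (Fin n)) (hd : d ≠ 0)
    (hmin : ∀ z, omegaReg (q + 2) σ f x (x + d) ≤ omegaReg (q + 2) σ f x z) :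
    -(σ * ‖d‖ ^ (q + 1) * ‖h‖ ^ 2 / (Nat.factorial (q + 1) : ℝ)) ≤
      ∑ j ∈ Finset.range (q + 1),
        iteratedFDeriv ℝ (j + 2) f x (Fin.cons h (Fin.cons h (fun _ => d)))
          / (Nat.factorial j : ℝ) := by
  obtain ⟨c, hc, hder⟩ := hasDerivAt_norm_pow_mul_inner_line d h q hd
  have hne : ∀ᶠ s : ℝ in nhds 0, d + s • h ≠ 0 := by
    have : ContinuousAt (fun s : ℝ => d + s • h) 0 := by fun_prop
    exact this.eventually_ne (by simpa using hd)
  have hfac : ∀ j : ℕ, (Nat.factorial (j + 1) : ℝ) = (j + 1) * Nat.factorial j := by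
    intro j; push_cast [Nat.factorial_succ]; ring
  have key := second_deriv_nonneg_of_min
    (g := fun s : ℝ => omegaReg (q + 2) σ f x (x + (d + s • h)))
    (g' := fun s : ℝ => (∑ j ∈ Finset.range (q + 2),
      iteratedFDeriv ℝ (j + 1) f x (Fin.cons h (fun _ => d + s • h)) / (Nat.factorial j : ℝ))
      + σ / (Nat.factorial (q + 2) : ℝ) * (‖d + s • h‖ ^ (q + 1) * inner ℝ (d + s • h) h))
    (c := (∑ j ∈ Finset.range (q + 1),
      iteratedFDeriv ℝ (j + 2) f x (Fin.cons h (Fin.cons h (fun _ => d))) / (Nat.factorial j : ℝ))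
      + σ / (Nat.factorial (q + 2) : ℝ) * c)
    (fun s => by simpa only [zero_smul, add_zero] using hmin _)
    (hne.mono fun s hs => by
      simp only [omegaReg, taylorPoly_eq_sum_range, add_sub_cancel_left]
      refine HasDerivAt.add ?_ ?_
      · simp_rw [Finset.sum_range_succ' _ (q + 2)]
        simp only [iteratedFDeriv_zero_apply]
        refine HasDerivAt.add_const _ (HasDerivAt.fun_sum fun j hj => ?_)
        convert! (hasDerivAt_iteratedFDeriv_const_line hf
          (by simpa [Nat.lt_iff_add_one_le] using hj) x d h s).div_const
          (Nat.factorial (j + 1) : ℝ) using 1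
        rw [hfac]
        field_simp
      · convert! (hasDerivAt_norm_pow_line d h (q + 1) hs).const_mul
          (σ / (Nat.factorial (q + 2 + 1) : ℝ)) using 1
        rw [hfac (q + 2)]
        push_cast
        field_simp
        ring)
    (by
      refine HasDerivAt.add ?_ (hder.const_mul _)
      simp_rw [Finset.sum_range_succ' _ (q + 1)]
      have h0 : HasDerivAt (fun s : ℝ => iteratedFDeriv ℝ (0 + 1) f x
          (Fin.cons h (fun _ => d + s • h)) / (Nat.factorial 0 : ℝ)) 0 0 := by
        have : ∀ s : ℝ, (Fin.cons h (fun _ => d + s • h) : Fin (0 + 1) → _) = fun _ => h := by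
          intro s; ext1 i; obtain rfl : i = 0 := Subsingleton.elim (α := Fin 1) i 0; simp
        simp_rw [this]
        exact hasDerivAt_const _ _
      refine ((HasDerivAt.fun_sum fun j hj => ?_).add h0).congr_deriv (add_zero _)
      convert! (hasDerivAt_iteratedFDeriv_cons_line hf
          (by simpa [Nat.lt_iff_add_one_le] using hj) x d h 0).div_const
          (Nat.factorial (j + 1) : ℝ) using 1
      rw [hfac]
      simp only [zero_smul, add_zero]
      field_simp)
  have hb : σ / (Nat.factorial (q + 2) : ℝ) * c
      ≤ σ * ‖d‖ ^ (q + 1) * ‖h‖ ^ 2 / (Nat.factorial (q + 1) : ℝ) := by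
    calc _ ≤ σ / (Nat.factorial (q + 2) : ℝ) * ((q + 2 : ℝ) * ‖d‖ ^ (q + 1) * ‖h‖ ^ 2) := by gcongr
      _ = _ := by
        rw [hfac (q + 1)]
        push_cast
        field_simp
        ring
  linarith

theorem HAR_successful_second_order
    {n : ℕ} (p : ℕ) (hp : 2 ≤ p)
    (f : EuclideanSpace ℝ (Fin n) → ℝ) (Lp : ℝ)
    (hf : ContDiff ℝ p f)
    (hLip : ∀ x y : EuclideanSpace ℝ (Fin n),
      ‖iteratedFDeriv ℝ p f x - iteratedFDeriv ℝ p f y‖ ≤ Lp * ‖x - y‖)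
    (xstar : EuclideanSpace ℝ (Fin n)) (hminF : ∀ z, f xstar ≤ f z)
    (α : ℝ) (hα : 1 < α)
    (x d : ℕ → EuclideanSpace ℝ (Fin n)) (H M : ℕ → ℝ)
    (hH0 : 0 < H 0) (hM0 : M 0 = H 0)
    (hM : ∀ k, 1 ≤ k → M k = max (M (k - 1)) (H (k - 1)))
    (hdmin : ∀ k, 1 ≤ k → ∀ z : EuclideanSpace ℝ (Fin n),
      omegaReg p (α * M k) f (x (k - 1)) (x (k - 1) + d k)
        ≤ omegaReg p (α * M k) f (x (k - 1)) z)
    (hdne : ∀ k, 1 ≤ k → d k ≠ 0)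
    (hxk : ∀ k, 1 ≤ k →
      x k = if f (x (k - 1) + d k) ≤ f (x (k - 1)) then x (k - 1) + d k else x (k - 1))
    (hHk : ∀ k, 1 ≤ k → H k / (Nat.factorial (p + 1) : ℝ)
      = (f (x (k - 1) + d k) - taylorPoly p f (x (k - 1)) (x (k - 1) + d k)) / ‖d k‖ ^ (p + 1)) :
    ∀ k : ℕ, 1 ≤ k → 2 * H k ≤ (α + 1) * M k →
      x k = x (k - 1) + d k ∧
      ∀ h : EuclideanSpace ℝ (Fin n),
        -((2 * α * Hmax (H 0) Lp / (Nat.factorial (p - 1) : ℝ)) * ‖d k‖ ^ (p - 1) * ‖h‖ ^ 2)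
          ≤ iteratedFDeriv ℝ 2 f (x k) (fun _ => h) := by
  obtain ⟨q, rfl⟩ : ∃ q, p = q + 2 := ⟨p - 2, by omega⟩
  have hH : ∀ k, H k ≤ Hmax (H 0) Lp := by
    intro k
    rcases Nat.eq_zero_or_pos k with rfl | hk
    · exact le_max_left _ _
    · refine le_trans ?_ (le_max_right _ _)
      have hT := (le_abs_self _).trans (abs_sub_taylor_le hf hLip (x (k - 1)) (d k))
      rw [← taylorPoly_eq_sum_range] at hT
      have hdk : 0 < ‖d k‖ := norm_pos_iff.2 (hdne k hk)
      have hfac : (0 : ℝ) < Nat.factorial (q + 2 + 1) := by positivity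
      have h1 : H k / (Nat.factorial (q + 2 + 1) : ℝ) ≤ Lp / (Nat.factorial (q + 2 + 1) : ℝ) := by
        rw [hHk k hk, div_le_iff₀ (by positivity)]
        exact hT.trans_eq (by ring)
      exact (div_le_div_iff_of_pos_right hfac).1 h1
  have hMb : ∀ k, 0 < M k ∧ M k ≤ Hmax (H 0) Lp := by
    intro k
    induction k with
    | zero => exact ⟨by rw [hM0]; exact hH0, by rw [hM0]; exact hH 0⟩
    | succ k ih =>
      rw [hM (k + 1) (by omega), Nat.add_sub_cancel]
      exact ⟨lt_max_of_lt_left ih.1, max_le ih.2 (hH k)⟩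
  intro k hk hsucc
  obtain ⟨hMpos, hMle⟩ := hMb k
  have hHM : H k ≤ α * M k := by nlinarith
  have hdk : 0 < ‖d k‖ := norm_pos_iff.2 (hdne k hk)
  have hstep : x k = x (k - 1) + d k := by
    rw [hxk k hk, if_pos]
    have h1 := hdmin k hk (x (k - 1))
    have h2 : taylorPoly (q + 2) f (x (k - 1)) (x (k - 1)) = f (x (k - 1)) := by
      have := taylorPoly_eq_sum_range (q + 2) f (x (k - 1)) 0
      rw [add_zero] at this
      rw [this, Finset.sum_range_succ']
      simp only [iteratedFDeriv_zero_apply, Nat.factorial_zero, Nat.cast_one, div_one]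
      rw [Finset.sum_eq_zero, zero_add]
      intro j _
      rw [(iteratedFDeriv ℝ (j + 1) f (x (k - 1))).map_coord_zero 0 rfl, zero_div]
    have h3 := hHk k hk
    rw [eq_div_iff (by positivity)] at h3
    simp only [omegaReg, h2, add_sub_cancel_left, sub_self, norm_zero, ne_eq,
      Nat.succ_ne_zero, not_false_eq_true, zero_pow, mul_zero, add_zero] at h1
    have h4 : H k / (Nat.factorial (q + 2 + 1) : ℝ) * ‖d k‖ ^ (q + 2 + 1)
        ≤ α * M k / (Nat.factorial (q + 2 + 1) : ℝ) * ‖d k‖ ^ (q + 2 + 1) := by gcongr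
    linarith
  refine ⟨hstep, fun h => ?_⟩
  rw [hstep]
  have hT := (abs_le.1 (abs_hessian_sub_taylor_le hf hLip (x (k - 1)) (d k) h)).1
  have hO := hessian_taylor_ge_of_min hf (by positivity : 0 ≤ α * M k) (x (k - 1)) (d k) h
    (hdne k hk) (hdmin k hk)
  have hcoef : α * M k + Lp ≤ 2 * α * Hmax (H 0) Lp := by
    have h1 : Lp ≤ Hmax (H 0) Lp := le_max_right _ _
    nlinarith
  have hle : (α * M k + Lp) * (‖d k‖ ^ (q + 1) * ‖h‖ ^ 2 / (Nat.factorial (q + 1) : ℝ))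
      ≤ 2 * α * Hmax (H 0) Lp * (‖d k‖ ^ (q + 1) * ‖h‖ ^ 2 / (Nat.factorial (q + 1) : ℝ)) := by
    gcongr
  have hfac : q + 2 - 1 = q + 1 := rfl
  rw [hfac]
  ring_nf at hT hO hle ⊢
  linarith
end
end

section
/- Consider the HAR-C method with budget B satisfying B ≥ Ū + 1. Suppose in addition that f is convex and that the initial sublevel set {x ∈ dom ψ : F(x) ≤ F(x^0)} has diameter at most R < ∞. Then for every integer k with k(1 − Ū/B) − Ū > 0, F(x^k) − F(x⋆) ≤ (2 α H_max R^{p+1} / p!) · ((p+1)/(k(1 − Ū/B) − Ū))^p, where H_max = max{H_0, L_p} and Ū = ⌈log_{(α+1)/2}(H_max/H_0)⌉. -/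
open scoped BigOperators RealInnerProductSpace

noncomputable section

/-- The derivatives of `f` along a line are the diagonal values of its iterated derivatives. -/
lemma iteratedDeriv_comp_add_smul {E F : Type*} [NormedAddCommGroup E] [NormedSpace ℝ E]
    [NormedAddCommGroup F] [NormedSpace ℝ F] {f : E → F} {N : WithTop ℕ∞}
    (hf : ContDiff ℝ N f) (x v : E) {i : ℕ} (hi : (i : WithTop ℕ∞) ≤ N) (t : ℝ) :
    iteratedDeriv i (fun s : ℝ => f (x + s • v)) t
      = iteratedFDeriv ℝ i f (x + t • v) (fun _ => v) := by
  have hshift : ContDiff ℝ N (fun z => f (x + z)) := hf.comp (contDiff_const.add contDiff_id)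
  have h := (ContinuousLinearMap.toSpanSingleton ℝ v).iteratedFDeriv_comp_right hshift t hi
  rw [iteratedFDeriv_comp_add_left] at h
  have h' := congrArg (fun L => L (fun _ => (1 : ℝ))) h
  simpa [iteratedDeriv_eq_iteratedFDeriv, Function.comp_def,
    ContinuousLinearMap.toSpanSingleton_apply] using h'

/-- If the `p`-th derivative of `g` moves by at most `A t` from `0` to `t`, the Taylor remainder
of `g` is at most `A t ^ (p + 1) / (p + 1)!`. -/
lemma abs_sub_taylor_le_of_iteratedDeriv {A : ℝ} (p : ℕ) (g : ℝ → ℝ) (hg : ContDiff ℝ p g)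
    (hA : ∀ t, 0 ≤ t → |iteratedDeriv p g t - iteratedDeriv p g 0| ≤ A * t) (t : ℝ)
    (ht : 0 ≤ t) :
    |g t - ∑ i ∈ Finset.range (p + 1), iteratedDeriv i g 0 * (t ^ i / (Nat.factorial i : ℝ))|
      ≤ A * (t ^ (p + 1) / (Nat.factorial (p + 1) : ℝ)) := by
  induction p generalizing g t with
  | zero => simpa using hA t ht
  | succ p ih =>
    have hg' : ContDiff ℝ p (deriv g) :=
      (contDiff_succ_iff_deriv.1 (by exact_mod_cast hg)).2.2
    have hdiff : Differentiable ℝ g := hg.differentiable (by simp)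
    have hbound := ih (deriv g) hg' (by simpa only [iteratedDeriv_succ'] using hA)
    have hpow : ∀ (i : ℕ) (s : ℝ), HasDerivAt
        (fun s : ℝ => s ^ (i + 1) / (Nat.factorial (i + 1) : ℝ))
        (s ^ i / (Nat.factorial i : ℝ)) s := by
      intro i s
      refine ((hasDerivAt_pow (i + 1) s).div_const _).congr_deriv ?_
      rw [Nat.factorial_succ]
      push_cast
      field_simp
    have hderiv : ∀ s : ℝ, HasDerivAt
        (fun s => g s - ∑ i ∈ Finset.range (p + 1 + 1),
          iteratedDeriv i g 0 * (s ^ i / (Nat.factorial i : ℝ)))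
        (deriv g s - ∑ i ∈ Finset.range (p + 1),
          iteratedDeriv i (deriv g) 0 * (s ^ i / (Nat.factorial i : ℝ))) s := by
      intro s
      refine (hdiff s).hasDerivAt.sub ?_
      simp_rw [Finset.sum_range_succ' _ (p + 1)]
      simp only [iteratedDeriv_succ', pow_zero]
      exact (HasDerivAt.fun_sum fun i _ => (hpow i s).const_mul _).add_const _
    refine image_norm_le_of_norm_deriv_right_le_deriv_boundary (a := 0) (b := t)
      (B := fun s => A * (s ^ (p + 1 + 1) / (Nat.factorial (p + 1 + 1) : ℝ)))
      (fun s _ => (hderiv s).continuousAt.continuousWithinAt)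
      (fun s _ => (hderiv s).hasDerivWithinAt) ?_ (fun s => (hpow (p + 1) s).const_mul A)
      (fun s hs => hbound s hs.1) ⟨ht, le_rfl⟩
    simp [Finset.sum_range_succ']

/-- Taylor's inequality for a function whose `p`-th derivative is Lipschitz. -/
lemma abs_sub_taylorPoly_le {n p : ℕ} {f : EuclideanSpace ℝ (Fin n) → ℝ} {L : ℝ}
    (hf : ContDiff ℝ p f)
    (hL : ∀ x y : EuclideanSpace ℝ (Fin n),
      ‖iteratedFDeriv ℝ p f x - iteratedFDeriv ℝ p f y‖ ≤ L * ‖x - y‖)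
    (x y : EuclideanSpace ℝ (Fin n)) :
    |f y - taylorPoly p f x y| ≤ L / (Nat.factorial (p + 1) : ℝ) * ‖y - x‖ ^ (p + 1) := by
  set v := y - x
  have hderiv : ∀ i ≤ p, ∀ t : ℝ, iteratedDeriv i (fun s : ℝ => f (x + s • v)) t
      = iteratedFDeriv ℝ i f (x + t • v) (fun _ => v) := fun i hi t =>
    iteratedDeriv_comp_add_smul hf x v (by exact_mod_cast hi) t
  have hline : ContDiff ℝ p (fun s : ℝ => f (x + s • v)) :=
    hf.comp (contDiff_const.add (contDiff_id.smul contDiff_const))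
  have h := abs_sub_taylor_le_of_iteratedDeriv (A := L * ‖v‖ ^ (p + 1)) p _ hline ?_ 1 zero_le_one
  · have hsum : ∑ i ∈ Finset.range (p + 1), iteratedDeriv i (fun s : ℝ => f (x + s • v)) 0
        * ((1 : ℝ) ^ i / (Nat.factorial i : ℝ)) = taylorPoly p f x y := by
      rw [Finset.range_eq_Ico, Finset.sum_eq_sum_Ico_succ_bot (Nat.succ_pos p), taylorPoly]
      refine congrArg₂ (· + ·) (by simp) (Finset.sum_congr ?_ ?_)
      · rfl
      · intro i hi
        rw [hderiv i (Finset.mem_Icc.1 hi).2]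
        simp [mul_comm, v]
    rw [hsum] at h
    have hy : x + (1 : ℝ) • v = y := by simp [v]
    rw [hy] at h
    refine h.trans_eq ?_
    rw [one_pow]
    ring
  · intro t ht
    rw [hderiv p le_rfl, hderiv p le_rfl, ← sub_apply,
      ← Real.norm_eq_abs]
    refine (ContinuousMultilinearMap.le_opNorm _ _).trans ?_
    have h := hL (x + t • v) (x + (0 : ℝ) • v)
    have he : x + t • v - (x + (0 : ℝ) • v) = t • v := by simp
    rw [he, norm_smul, Real.norm_of_nonneg ht] at h
    simp only [Finset.prod_const, Finset.card_univ, Fintype.card_fin]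
    calc _ ≤ L * (t * ‖v‖) * ‖v‖ ^ p := by gcongr
      _ = _ := by ring

/-- Counting failures: if a level `M`, reset to at least `h` at multiples of `B`, grows by a
factor `γ` with each failure and stays below `h γ ^ (U + 1)`, then at most `U` failures occur
between two resets. -/
lemma card_failures_le {γ h : ℝ} (hγ : 1 < γ) {M H : ℕ → ℝ} {B U : ℕ}
    (hreset : ∀ k, h ≤ M k)
    (hM : ∀ k, ¬ B ∣ k + 1 → max (M k) (H k) ≤ M (k + 1))
    (hU : ∀ k (v : ℕ), h * γ ^ v ≤ max (M k) (H k) → v ≤ U) (k : ℕ) :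
    ((Finset.range k).filter fun j => γ * M (j + 1) < H (j + 1)).card ≤ U * (k / B + 1) := by
  suffices hk : ∃ v : ℕ, h * γ ^ v ≤ max (M k) (H k) ∧
      ((Finset.range k).filter fun j => γ * M (j + 1) < H (j + 1)).card ≤ U * (k / B) + v by
    obtain ⟨v, hv, hcard⟩ := hk
    have := hU k v hv
    linarith [mul_add U (k / B) 1]
  induction k with
  | zero => exact ⟨0, by simp [hreset 0], by simp⟩
  | succ k ih =>
    obtain ⟨v, hv, hcard⟩ := ih
    have hstart : ∃ w : ℕ, h * γ ^ w ≤ M (k + 1) ∧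
        ((Finset.range k).filter fun j => γ * M (j + 1) < H (j + 1)).card
          ≤ U * ((k + 1) / B) + w := by
      by_cases hdvd : B ∣ k + 1
      · refine ⟨0, by simpa using hreset (k + 1), ?_⟩
        have := hU k v hv
        rw [Nat.succ_div, if_pos hdvd]
        linarith [mul_add U (k / B) 1]
      · refine ⟨v, hv.trans (hM k hdvd), ?_⟩
        rwa [Nat.succ_div, if_neg hdvd]
    obtain ⟨w, hw, hcw⟩ := hstart
    rw [Finset.range_add_one, Finset.filter_insert]
    split_ifs with hfail
    · refine ⟨w + 1, le_max_of_le_right ?_, ?_⟩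
      · calc h * γ ^ (w + 1) = γ * (h * γ ^ w) := by ring
          _ ≤ γ * M (k + 1) := by gcongr
          _ ≤ H (k + 1) := hfail.le
      · rw [Finset.card_insert_of_notMem (by simp)]
        omega
    · exact ⟨w, le_max_of_le_left hw, hcw⟩

/-- A sequence which never increases and which satisfies the recursion
`δ ≤ (1 - θ) δ' + C / (p + 1)! * θ ^ (p + 1)`, for all `θ ∈ [0, 1]`, at good indices, decays like the
`p`-th power of the number of good indices. -/
lemma ascFactorial_mul_le_of_recursion {p : ℕ} {C : ℝ} (hC : 0 ≤ C) {δ : ℕ → ℝ}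
    (good : ℕ → Prop) [DecidablePred good] (hmono : ∀ k, δ (k + 1) ≤ δ k)
    (hrec : ∀ k, good k → ∀ θ ∈ Set.Icc (0 : ℝ) 1,
      δ (k + 1) ≤ (1 - θ) * δ k + C / (Nat.factorial (p + 1) : ℝ) * θ ^ (p + 1)) (k : ℕ) :
    ((((Finset.range k).filter good).card).ascFactorial (p + 1) : ℝ) * δ k
      ≤ C / (Nat.factorial p : ℝ) * ((p : ℝ) + 1) ^ p * ((Finset.range k).filter good).card := by
  induction k with
  | zero => simp [Nat.zero_ascFactorial]
  | succ k ih =>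
    rw [Finset.range_add_one, Finset.filter_insert]
    set s := ((Finset.range k).filter good).card
    split_ifs with hgood
    · rw [Finset.card_insert_of_notMem (by simp)]
      have hden : (0 : ℝ) < (s : ℝ) + p + 1 := by positivity
      have hθ := hrec k hgood (((p : ℝ) + 1) / (s + p + 1))
        ⟨by positivity, (div_le_one hden).2 (by linarith [s.cast_nonneg (α := ℝ)])⟩
      have hshift : (s : ℝ) * ((s + 1).ascFactorial (p + 1) : ℝ)
          = (s + p + 1) * (s.ascFactorial (p + 1) : ℝ) := by
        exact_mod_cast Nat.succ_ascFactorial s (p + 1)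
      have hle : ((s + 1).ascFactorial (p + 1) : ℝ) ≤ ((s : ℝ) + p + 1) ^ (p + 1) := by
        exact_mod_cast Nat.ascFactorial_le_pow_add s (p + 1)
      have hfac : (Nat.factorial (p + 1) : ℝ) = (p + 1) * Nat.factorial p := by
        exact_mod_cast Nat.factorial_succ p
      have hfpos : (0 : ℝ) < Nat.factorial p := by positivity
      set P := ((s + 1).ascFactorial (p + 1) : ℝ)
      have hP : 0 ≤ P := Nat.cast_nonneg _
      calc P * δ (k + 1)
          ≤ P * ((1 - ((p : ℝ) + 1) / (s + p + 1)) * δ k + C / (Nat.factorial (p + 1) : ℝ)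
              * (((p : ℝ) + 1) / (s + p + 1)) ^ (p + 1)) := by gcongr
        _ = (s * P) / (s + p + 1) * δ k + C / (Nat.factorial p : ℝ) * ((p : ℝ) + 1) ^ p
              * (P / ((s : ℝ) + p + 1) ^ (p + 1)) := by
            rw [hfac, div_pow]
            field_simp
            ring
        _ = (s.ascFactorial (p + 1) : ℝ) * δ k + C / (Nat.factorial p : ℝ) * ((p : ℝ) + 1) ^ p
              * (P / ((s : ℝ) + p + 1) ^ (p + 1)) := by
            rw [hshift, mul_div_cancel_left₀ _ hden.ne']
        _ ≤ C / (Nat.factorial p : ℝ) * ((p : ℝ) + 1) ^ p * s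
              + C / (Nat.factorial p : ℝ) * ((p : ℝ) + 1) ^ p * 1 := by
            gcongr
            exact div_le_one_of_le₀ hle (by positivity)
        _ = _ := by push_cast; ring
    · exact (mul_le_mul_of_nonneg_left (hmono k) (Nat.cast_nonneg _)).trans ih

/-- Rate form of `ascFactorial_mul_le_of_recursion`. -/
lemma le_rate_of_recursion {p : ℕ} {C : ℝ} (hC : 0 ≤ C) {δ : ℕ → ℝ}
    (good : ℕ → Prop) [DecidablePred good] (hmono : ∀ k, δ (k + 1) ≤ δ k)
    (hrec : ∀ k, good k → ∀ θ ∈ Set.Icc (0 : ℝ) 1,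
      δ (k + 1) ≤ (1 - θ) * δ k + C / (Nat.factorial (p + 1) : ℝ) * θ ^ (p + 1)) (k : ℕ)
    {N : ℝ} (hN : 0 < N) (hNs : N ≤ ((Finset.range k).filter good).card) :
    δ k ≤ C / (Nat.factorial p : ℝ) * (((p : ℝ) + 1) / N) ^ p := by
  have h := ascFactorial_mul_le_of_recursion hC good hmono hrec k
  set s := ((Finset.range k).filter good).card
  have hs : (0 : ℝ) < s := hN.trans_le hNs
  have hpow : (s : ℝ) ^ (p + 1) ≤ (s.ascFactorial (p + 1) : ℝ) := by
    exact_mod_cast Nat.pow_succ_le_ascFactorial s (p + 1)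
  have hA : (0 : ℝ) < (s.ascFactorial (p + 1) : ℝ) := (pow_pos hs _).trans_le hpow
  calc δ k ≤ C / (Nat.factorial p : ℝ) * ((p : ℝ) + 1) ^ p * s / (s.ascFactorial (p + 1) : ℝ) :=
        (le_div_iff₀' hA).2 h
    _ ≤ C / (Nat.factorial p : ℝ) * ((p : ℝ) + 1) ^ p * s / (s : ℝ) ^ (p + 1) := by gcongr
    _ = C / (Nat.factorial p : ℝ) * (((p : ℝ) + 1) / s) ^ p := by
        rw [div_pow]
        field_simp
        ring
    _ ≤ _ := by gcongr

/-- One step with the regularized model, tested on the segment towards `w`. -/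
lemma le_of_isMin_omegaReg {n p : ℕ} {f ψ : EuclideanSpace ℝ (Fin n) → ℝ}
    {s : Set (EuclideanSpace ℝ (Fin n))} {L σ Q R : ℝ} {x y w : EuclideanSpace ℝ (Fin n)}
    (hf : ContDiff ℝ p f)
    (hL : ∀ x y : EuclideanSpace ℝ (Fin n),
      ‖iteratedFDeriv ℝ p f x - iteratedFDeriv ℝ p f y‖ ≤ L * ‖x - y‖)
    (hfconv : ConvexOn ℝ Set.univ f) (hψ : ConvexOn ℝ s ψ) (hx : x ∈ s) (hw : w ∈ s)
    (hmin : ∀ z ∈ s, omegaReg p σ f x y + ψ y ≤ omegaReg p σ f x z + ψ z)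
    (hupper : f y ≤ omegaReg p σ f x y) (hQ : 0 ≤ Q) (hLQ : L + σ ≤ Q) (hR : ‖w - x‖ ≤ R)
    {θ : ℝ} (hθ : θ ∈ Set.Icc (0 : ℝ) 1) :
    f y + ψ y ≤ (1 - θ) * (f x + ψ x) + θ * (f w + ψ w)
      + Q * R ^ (p + 1) / (Nat.factorial (p + 1) : ℝ) * θ ^ (p + 1) := by
  obtain ⟨hθ0, hθ1⟩ := hθ
  set z := (1 - θ) • x + θ • w
  have hz : z ∈ s := hψ.1 hx hw (sub_nonneg.2 hθ1) hθ0 (by ring)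
  have hfz : f z ≤ (1 - θ) * f x + θ * f w :=
    hfconv.2 (Set.mem_univ x) (Set.mem_univ w) (sub_nonneg.2 hθ1) hθ0 (by ring)
  have hψz : ψ z ≤ (1 - θ) * ψ x + θ * ψ w := hψ.2 hx hw (sub_nonneg.2 hθ1) hθ0 (by ring)
  have hzx : z - x = θ • (w - x) := by simp only [z]; module
  have htaylor := (abs_le.1 (abs_sub_taylorPoly_le hf hL x z)).1
  have hm := hmin z hz
  have hreg : omegaReg p σ f x z
      = taylorPoly p f x z + σ / (Nat.factorial (p + 1) : ℝ) * ‖z - x‖ ^ (p + 1) := rfl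
  have hnorm : ‖z - x‖ ≤ θ * R := by
    rw [hzx, norm_smul, Real.norm_of_nonneg hθ0]
    gcongr
  have hrem : (L + σ) / (Nat.factorial (p + 1) : ℝ) * ‖z - x‖ ^ (p + 1)
      ≤ Q * R ^ (p + 1) / (Nat.factorial (p + 1) : ℝ) * θ ^ (p + 1) :=
    calc _ ≤ Q / (Nat.factorial (p + 1) : ℝ) * (θ * R) ^ (p + 1) := by gcongr
      _ = _ := by rw [mul_pow]; ring
  rw [add_div, add_mul] at hrem
  linarith

theorem HARC_convex_rate
    {n : ℕ} (p : ℕ) (hp : 1 ≤ p)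
    (f : EuclideanSpace ℝ (Fin n) → ℝ) (Lp : ℝ)
    (hf : ContDiff ℝ p f)
    (hLip : ∀ x y : EuclideanSpace ℝ (Fin n),
      ‖iteratedFDeriv ℝ p f x - iteratedFDeriv ℝ p f y‖ ≤ Lp * ‖x - y‖)
    (domψ : Set (EuclideanSpace ℝ (Fin n))) (ψ : EuclideanSpace ℝ (Fin n) → ℝ)
    (hdom_ne : domψ.Nonempty) (hdom_closed : IsClosed domψ) (hdom_conv : Convex ℝ domψ)
    (hψconv : ConvexOn ℝ domψ ψ) (hψlsc : LowerSemicontinuousOn ψ domψ)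
    (xstar : EuclideanSpace ℝ (Fin n)) (hstar : xstar ∈ domψ)
    (hminF : ∀ z ∈ domψ, f xstar + ψ xstar ≤ f z + ψ z)
    (α : ℝ) (hα : 1 < α)
    (x d : ℕ → EuclideanSpace ℝ (Fin n)) (H M : ℕ → ℝ)
    (hx0 : x 0 ∈ domψ) (hH0 : 0 < H 0) (hM0 : M 0 = H 0)
    (B : ℕ) (hB : Ubar α (H 0) Lp + 1 ≤ (B : ℤ))
    (hM : ∀ k, 1 ≤ k →
      M k = if k % B = 0 then max (H 0) (H (k - 1)) else max (M (k - 1)) (H (k - 1)))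
    (hdmem : ∀ k, 1 ≤ k → x (k - 1) + d k ∈ domψ)
    (hdmin : ∀ k, 1 ≤ k → ∀ z ∈ domψ,
      omegaReg p (α * M k) f (x (k - 1)) (x (k - 1) + d k) + ψ (x (k - 1) + d k)
        ≤ omegaReg p (α * M k) f (x (k - 1)) z + ψ z)
    (hdne : ∀ k, 1 ≤ k → d k ≠ 0)
    (hxk : ∀ k, 1 ≤ k →
      x k = if f (x (k - 1) + d k) + ψ (x (k - 1) + d k) ≤ f (x (k - 1)) + ψ (x (k - 1))
            then x (k - 1) + d k else x (k - 1))
    (hHk : ∀ k, 1 ≤ k → H k / (Nat.factorial (p + 1) : ℝ)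
      = (f (x (k - 1) + d k) - taylorPoly p f (x (k - 1)) (x (k - 1) + d k)) / ‖d k‖ ^ (p + 1))
    (hfconv : ConvexOn ℝ Set.univ f) (R : ℝ)
    (hR : ∀ z ∈ domψ, f z + ψ z ≤ f (x 0) + ψ (x 0) →
      ∀ w ∈ domψ, f w + ψ w ≤ f (x 0) + ψ (x 0) → ‖z - w‖ ≤ R) :
    ∀ k : ℕ,
      0 < (k : ℝ) * (1 - (Ubar α (H 0) Lp : ℝ) / (B : ℝ)) - (Ubar α (H 0) Lp : ℝ) →
      f (x k) + ψ (x k) - (f xstar + ψ xstar)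
        ≤ (2 * α * Hmax (H 0) Lp * R ^ (p + 1) / (Nat.factorial p : ℝ))
          * (((p : ℝ) + 1)
              / ((k : ℝ) * (1 - (Ubar α (H 0) Lp : ℝ) / (B : ℝ)) - (Ubar α (H 0) Lp : ℝ))) ^ p := by
  intro k hN
  set F : EuclideanSpace ℝ (Fin n) → ℝ := fun z => f z + ψ z with hF
  have hα0 : 0 < α := one_pos.trans hα
  have hγ : 1 < (α + 1) / 2 := by linarith
  have hmax0 : H 0 ≤ Hmax (H 0) Lp := le_max_left _ _
  have hmaxL : Lp ≤ Hmax (H 0) Lp := le_max_right _ _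
  have hfact : (0 : ℝ) < Nat.factorial (p + 1) := by positivity
  have hHle : ∀ j, H j ≤ Hmax (H 0) Lp := by
    intro j
    rcases Nat.eq_zero_or_pos j with rfl | hj
    · exact hmax0
    · have hd : 0 < ‖d j‖ ^ (p + 1) := pow_pos (norm_pos_iff.2 (hdne j hj)) _
      have ht := (abs_le.1 (abs_sub_taylorPoly_le hf hLip (x (j - 1)) (x (j - 1) + d j))).2
      rw [add_sub_cancel_left, ← div_le_iff₀ hd, ← hHk j hj, div_le_div_iff_of_pos_right hfact]
        at ht
      exact ht.trans hmaxL
  have hMle : ∀ j, M j ≤ Hmax (H 0) Lp := by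
    intro j
    induction j with
    | zero => rw [hM0]; exact hmax0
    | succ j ih =>
      rw [hM (j + 1) (by omega), Nat.add_sub_cancel]
      split_ifs
      · exact max_le hmax0 (hHle j)
      · exact max_le ih (hHle j)
  have hMge : ∀ j, H 0 ≤ M j := by
    intro j
    induction j with
    | zero => rw [hM0]
    | succ j ih =>
      rw [hM (j + 1) (by omega), Nat.add_sub_cancel]
      split_ifs
      · exact le_max_left _ _
      · exact ih.trans (le_max_left _ _)
  have hxmem : ∀ j, x j ∈ domψ := by
    intro j
    induction j with
    | zero => exact hx0
    | succ j ih =>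
      rw [hxk (j + 1) (by omega), Nat.add_sub_cancel]
      split_ifs
      · exact hdmem (j + 1) (by omega)
      · exact ih
  have hstep : ∀ j, F (x (j + 1)) = min (F (x j + d (j + 1))) (F (x j)) := by
    intro j
    rw [hxk (j + 1) (by omega), Nat.add_sub_cancel]
    split_ifs with h
    · exact (min_eq_left h).symm
    · exact (min_eq_right (not_le.1 h).le).symm
  have hFmono : ∀ j, F (x (j + 1)) ≤ F (x j) := fun j => (hstep j).trans_le (min_le_right _ _)
  have hsub : ∀ j, F (x j) ≤ F (x 0) := fun j =>
    antitone_nat_of_succ_le (f := fun j => F (x j)) hFmono (Nat.zero_le j)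
  have hR0 : 0 ≤ R := by simpa using hR _ hx0 le_rfl _ hx0 le_rfl
  have hHm : 0 < Hmax (H 0) Lp := hH0.trans_le hmax0
  obtain ⟨U, hU⟩ : ∃ U : ℕ, Ubar α (H 0) Lp = U := by
    refine Int.eq_ofNat_of_zero_le (Int.ceil_nonneg ?_)
    exact Real.logb_nonneg hγ ((one_le_div hH0).2 hmax0)
  have hlevel : ∀ v : ℕ, H 0 * ((α + 1) / 2) ^ v ≤ Hmax (H 0) Lp → v ≤ U := by
    intro v hv
    have hlog : (v : ℝ) ≤ Real.logb ((α + 1) / 2) (Hmax (H 0) Lp / H 0) := by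
      rw [Real.le_logb_iff_rpow_le hγ (by positivity), Real.rpow_natCast, le_div_iff₀' hH0]
      exact hv
    have hceil : ((v : ℤ) : ℝ) ≤ (Ubar α (H 0) Lp : ℝ) := by
      exact_mod_cast hlog.trans (Int.le_ceil _)
    rw [hU] at hceil
    exact_mod_cast hceil
  have hBpos : 0 < B := by rw [hU] at hB; omega
  have hfail := card_failures_le (H := H) (B := B) (U := U) hγ hMge
    (fun j hj => by
      rw [hM (j + 1) (by omega), Nat.add_sub_cancel, if_neg (mt Nat.dvd_of_mod_eq_zero hj)])
    (fun j v hv => hlevel v (hv.trans (max_le (hMle j) (hHle j)))) k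
  have hcount := Finset.card_filter_add_card_filter_not (s := Finset.range k)
    (fun j => (α + 1) / 2 * M (j + 1) < H (j + 1))
  rw [Finset.card_range] at hcount
  refine le_rate_of_recursion (C := 2 * α * Hmax (H 0) Lp * R ^ (p + 1)) (by positivity)
    (δ := fun j => F (x j) - F xstar) (fun j => ¬ (α + 1) / 2 * M (j + 1) < H (j + 1))
    (fun j => sub_le_sub_right (hFmono j) _) ?_ k hN ?_
  · intro j hj θ hθ
    have hHM : H (j + 1) ≤ α * M (j + 1) := by
      have : 0 < M (j + 1) := hH0.trans_le (hMge _)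
      nlinarith [not_lt.1 hj]
    have hHk' := hHk (j + 1) (by omega)
    have hmin := hdmin (j + 1) (by omega)
    have hd : 0 < ‖d (j + 1)‖ ^ (p + 1) := pow_pos (norm_pos_iff.2 (hdne (j + 1) (by omega))) _
    rw [Nat.add_sub_cancel] at hHk' hmin
    have hupper : f (x j + d (j + 1)) ≤ omegaReg p (α * M (j + 1)) f (x j) (x j + d (j + 1)) := by
      rw [eq_div_iff hd.ne'] at hHk'
      rw [omegaReg, add_sub_cancel_left]
      have : H (j + 1) / (Nat.factorial (p + 1) : ℝ) * ‖d (j + 1)‖ ^ (p + 1)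
          ≤ α * M (j + 1) / (Nat.factorial (p + 1) : ℝ) * ‖d (j + 1)‖ ^ (p + 1) := by gcongr
      linarith
    have hdescent := le_of_isMin_omegaReg hf hLip hfconv hψconv (hxmem j) hstar hmin hupper
      (Q := 2 * α * Hmax (H 0) Lp) (by positivity)
      (by nlinarith [mul_le_mul_of_nonneg_left (hMle (j + 1)) hα0.le])
      (hR _ hstar (hminF _ hx0) _ (hxmem j) (hsub j)) hθ
    have hle : F (x (j + 1)) ≤ F (x j + d (j + 1)) := (hstep j).trans_le (min_le_left _ _)
    simp only [hF] at hle ⊢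
    linarith
  · have hfail' : (((Finset.range k).filter
        fun j => (α + 1) / 2 * M (j + 1) < H (j + 1)).card : ℝ) ≤ U * ((k : ℝ) / B + 1) := by
      refine (Nat.cast_le.2 hfail).trans ?_
      push_cast
      gcongr
      exact Nat.cast_div_le
    have hcount' := congrArg (Nat.cast : ℕ → ℝ) hcount
    push_cast at hcount'
    rw [hU, Int.cast_natCast]
    have : (k : ℝ) * (1 - U / B) - U = k - U * (k / B + 1) := by ring
    linarith
end
end
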